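/- arXiv:1907.12312 — 3 statements merged into one kernel-verified Lean document; each statement's English description precedes it below -/
import Mathlib

section
/- Every 3-dimensional lattice parallelepiped has a unimodular cover. -/
open scoped Pointwise

noncomputable section

/-- The real point corresponding to an integer point of `ℤ³`. -/
def toR3 (v : Fin 3 → ℤ) : Fin 3 → ℝ := fun i => (v i : ℝ)

/-- The set of lattice points of `ℝ³`. -/
def Lat3 : Set (Fin 3 → ℝ) := Set.range toR3

/-- A unimodular tetrahedron: the convex hull of lattice points `v0, v1, v2, v3`
such that `v1 - v0, v2 - v0, v3 - v0` form a `ℤ`-basis of `ℤ³`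
(equivalently, their determinant is `±1`). -/
def IsUnimodularTet (S : Set (Fin 3 → ℝ)) : Prop :=
  ∃ v : Fin 4 → Fin 3 → ℤ,
    S = convexHull ℝ {toR3 (v 0), toR3 (v 1), toR3 (v 2), toR3 (v 3)} ∧
    (Matrix.of ![v 1 - v 0, v 2 - v 0, v 3 - v 0]).det ∈ ({1, -1} : Set ℤ)

/-- A unimodular cover of `P`: a collection of unimodular tetrahedra contained
in `P` whose union is `P`. -/
def HasUnimodularCover (P : Set (Fin 3 → ℝ)) : Prop :=
  ∃ 𝒞 : Set (Set (Fin 3 → ℝ)),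
    (∀ S ∈ 𝒞, IsUnimodularTet S ∧ S ⊆ P) ∧ ⋃₀ 𝒞 = P

/-- The lattice parallelepiped `{v + λ₁a₁ + λ₂a₂ + λ₃a₃ : λᵢ ∈ [0,1]}`. -/
def Parallelepiped3 (v a₁ a₂ a₃ : Fin 3 → ℤ) : Set (Fin 3 → ℝ) :=
  {x | ∃ l₁ l₂ l₃ : ℝ, l₁ ∈ Set.Icc (0:ℝ) 1 ∧ l₂ ∈ Set.Icc (0:ℝ) 1 ∧
    l₃ ∈ Set.Icc (0:ℝ) 1 ∧
    x = toR3 v + l₁ • toR3 a₁ + l₂ • toR3 a₂ + l₃ • toR3 a₃}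

theorem star_aux (H : AddSubgroup (Fin 4 → ℝ)) (hZ : ∀ n : Fin 4 → ℤ, (fun j => (n j:ℝ)) ∈ H)
    (hs : ∀ b ∈ H, ∃ n : ℤ, ∑ j, b j = n)
    (hE : ¬ ∃ b ∈ H, ∑ j, b j = 1 ∧ ∀ j, 0 ≤ b j ∧ b j < 1)
    (b : Fin 4 → ℝ) (hb : b ∈ H) (j0 : Fin 4) (hj : Int.fract (b j0) ≠ 0) :
    (∀ j, 0 < Int.fract (b j)) ∧ ∑ j, Int.fract (b j) = 2 := by
  have hf : ∀ c ∈ H, (fun j => Int.fract (c j)) ∈ H := by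
    intro c hc
    have := H.sub_mem hc (hZ (fun j => ⌊c j⌋))
    exact this
  have key : ∀ c ∈ H, Int.fract (c j0) ≠ 0 → (2:ℝ) ≤ ∑ j, Int.fract (c j) := by
    intro c hc h0
    obtain ⟨n, hn⟩ := hs _ (hf c hc)
    have hpos : 0 < ∑ j, Int.fract (c j) :=
      Finset.sum_pos' (fun j _ => Int.fract_nonneg _)
        ⟨j0, Finset.mem_univ _, lt_of_le_of_ne (Int.fract_nonneg _) (Ne.symm h0)⟩
    have h1 : ∑ j, Int.fract (c j) ≠ 1 := fun h =>
      hE ⟨_, hf c hc, h, fun j => ⟨Int.fract_nonneg _, Int.fract_lt_one _⟩⟩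
    change ∑ j, Int.fract (c j) = _ at hn
    rw [hn] at hpos h1 ⊢
    have a : 0 < n := by exact_mod_cast hpos
    have b : n ≠ 1 := by exact_mod_cast h1
    have : 2 ≤ n := by omega
    exact_mod_cast this
  have k1 := key b hb hj
  have k2 := key (-b) (H.neg_mem hb) (by simpa [Int.fract_neg_eq_zero] using hj)
  have hle : ∀ j, (Int.fract (b j) = 0 ∧ Int.fract ((-b) j) = 0) ∨
      (0 < Int.fract (b j) ∧ Int.fract ((-b) j) = 1 - Int.fract (b j)) := by
    intro j
    by_cases h : Int.fract (b j) = 0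
    · left; exact ⟨h, by simpa [Int.fract_neg_eq_zero] using h⟩
    · right; exact ⟨lt_of_le_of_ne (Int.fract_nonneg _) (Ne.symm h), by simpa using Int.fract_neg h⟩
  rw [Fin.sum_univ_four] at k1 k2 ⊢
  have h0 := hle 0
  have h1 := hle 1
  have h2 := hle 2
  have h3 := hle 3
  have hall : 0 < Int.fract (b 0) ∧ 0 < Int.fract (b 1) ∧ 0 < Int.fract (b 2) ∧ 0 < Int.fract (b 3) := by
    rcases h0 with ⟨h0, h0'⟩ | ⟨h0, h0'⟩ <;> rcases h1 with ⟨h1, h1'⟩ | ⟨h1, h1'⟩ <;>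
    rcases h2 with ⟨h2, h2'⟩ | ⟨h2, h2'⟩ <;> rcases h3 with ⟨h3, h3'⟩ | ⟨h3, h3'⟩ <;>
    first
    | exact ⟨h0, h1, h2, h3⟩
    | (exfalso; linarith)
  refine ⟨?_, ?_⟩
  · intro j
    fin_cases j
    exacts [hall.1, hall.2.1, hall.2.2.1, hall.2.2.2]
  · obtain ⟨g0, g1, g2, g3⟩ := hall
    rcases h0 with ⟨h0, h0'⟩ | ⟨h0, h0'⟩ <;> rcases h1 with ⟨h1, h1'⟩ | ⟨h1, h1'⟩ <;>
    rcases h2 with ⟨h2, h2'⟩ | ⟨h2, h2'⟩ <;> rcases h3 with ⟨h3, h3'⟩ | ⟨h3, h3'⟩ <;> linarith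

theorem lemA (H : AddSubgroup (Fin 4 → ℝ)) (hZ : ∀ n : Fin 4 → ℤ, (fun j => (n j:ℝ)) ∈ H)
    (hs : ∀ b ∈ H, ∃ n : ℤ, ∑ j, b j = n)
    (N : ℤ) (hN0 : N ≠ 0) (hN : ∀ b ∈ H, ∀ j, ∃ n : ℤ, (N:ℝ) * b j = n)
    (b0 : Fin 4 → ℝ) (hb0 : b0 ∈ H) (j0 : Fin 4) (hj0 : Int.fract (b0 j0) ≠ 0) :
    (∃ b ∈ H, ∑ j, b j = 1 ∧ ∀ j, 0 ≤ b j ∧ b j < 1) ∨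
    ∀ i, ∃ b ∈ H, ∑ j, b j = 1 ∧ b i ≤ 0 ∧ ∀ j, j ≠ i → 0 ≤ b j + b i ∧ b j < 1 := by
  by_cases hE : ∃ b ∈ H, ∑ j, b j = 1 ∧ ∀ j, 0 ≤ b j ∧ b j < 1
  · exact Or.inl hE
  right
  intro i
  have star := star_aux H hZ hs hE
  have hei : (Pi.single i 1 : Fin 4 → ℝ) ∈ H := by
    have := hZ (Pi.single i 1)
    convert this using 1
    ext j
    by_cases h : j = i
    · subst h; simp
    · simp [h]
  -- minimal positive value
  have hex : ∃ n : ℕ, 0 < n ∧ ∃ g ∈ H, |(N:ℝ)| * g i = n := by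
    refine ⟨N.natAbs, by omega, _, hei, ?_⟩
    simp [Nat.cast_natAbs]
  classical
  obtain ⟨hn0, g, hg, hgn⟩ := Nat.find_spec hex
  have hmin := fun m => Nat.find_min (H := hex) (m := m)
  generalize Nat.find hex = n at *
  have hNpos : (0:ℝ) < |(N:ℝ)| := by positivity
  have hgpos : 0 < g i := by
    have : (0:ℝ) < n := by exact_mod_cast hn0
    by_contra h
    nlinarith
  have hmin' : ∀ c ∈ H, 0 ≤ c i → c i < g i → c i = 0 := by
    intro c hc h0 h1
    by_contra hne
    have hp : 0 < c i := lt_of_le_of_ne h0 (Ne.symm hne)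
    have : ∃ k : ℤ, |(N:ℝ)| * c i = k := by
      obtain ⟨k, hk⟩ := hN c hc i
      rcases abs_choice (N:ℝ) with h | h
      · exact ⟨k, by rw [h, hk]⟩
      · exact ⟨-k, by rw [h]; push_cast; rw [← hk]; ring⟩
    obtain ⟨k, hk⟩ := this
    have hkpos : 0 < k := by
      have : (0:ℝ) < k := by rw [← hk]; positivity
      exact_mod_cast this
    lift k to ℕ using hkpos.le
    have hkn : k < n := by
      have : (k:ℝ) < n := by
        have h3 := mul_lt_mul_of_pos_left h1 hNpos
        rw [hk, hgn] at h3
        exact_mod_cast h3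
      exact_mod_cast this
    exact hmin k hkn ⟨by exact_mod_cast hkpos, c, hc, by exact_mod_cast hk⟩
  -- 1 = m ε
  obtain ⟨m, hm⟩ : ∃ m : ℤ, (m:ℝ) * g i = 1 := by
    refine ⟨⌊1 / g i⌋, ?_⟩
    have h1 := Int.floor_le (1 / g i)
    have h2 := Int.lt_floor_add_one (1 / g i)
    rw [le_div_iff₀ hgpos] at h1
    rw [div_lt_iff₀ hgpos] at h2
    have := hmin' (Pi.single i 1 - ⌊1 / g i⌋ • g) (H.sub_mem hei (H.zsmul_mem hg _))
    simp at this
    have h3 := this (by simpa using h1) (by simp at h2; linarith)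
    simp
    linarith
  have hfrac : ∀ c ∈ H, Int.fract (c i) = 0 → ∀ j, Int.fract (c j) = 0 := by
    intro c hc h j
    by_contra hne
    have := (star c hc j hne).1 i
    linarith
  have hmg : ∀ j, ∃ k : ℤ, (m:ℝ) * g j = k := by
    intro j
    have h1 := hfrac (m • g) (H.zsmul_mem hg _) (by simp [hm]) j
    rw [Int.fract_eq_zero_iff] at h1
    obtain ⟨k, hk⟩ := h1
    exact ⟨k, by simpa using hk.symm⟩
  have hb0i : 0 < Int.fract (b0 i) := (star b0 hb0 j0 hj0).1 i
  have hg1 : g i < 1 := by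
    by_contra h
    have := hmin' (b0 - fun j => ((⌊b0 j⌋ : ℤ) : ℝ)) (H.sub_mem hb0 (hZ _)) (Int.fract_nonneg _)
      (lt_of_lt_of_le (Int.fract_lt_one _) (not_lt.1 h))
    have h2 : Int.fract (b0 i) = 0 := this
    linarith
  have hgi : Int.fract (g i) = g i := Int.fract_eq_self.2 ⟨hgpos.le, hg1⟩
  have hngi : Int.fract ((-g) i) = 1 - g i := by
    have := Int.fract_neg (x := g i) (by rw [hgi]; exact hgpos.ne')
    rw [hgi] at this
    simpa using this
  obtain ⟨s1, s2⟩ := star (-g) (H.neg_mem hg) i (by rw [hngi]; linarith)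
  have hmpos : (0:ℝ) < m := by
    by_contra h
    nlinarith
  refine ⟨(-g - fun j => ((⌊(-g) j⌋ : ℤ) : ℝ)) - Pi.single i 1,
    H.sub_mem (H.sub_mem (H.neg_mem hg) (hZ _)) hei, ?_, ?_, ?_⟩
  · have e : ∀ j, ((-g - fun j => ((⌊(-g) j⌋ : ℤ) : ℝ)) - Pi.single i 1 : Fin 4 → ℝ) j
        = Int.fract ((-g) j) - (Pi.single i 1 : Fin 4 → ℝ) j := fun j => rfl
    simp only [e, Finset.sum_sub_distrib, s2]
    simp
    norm_num
  · have e : ((-g - fun j => ((⌊(-g) j⌋ : ℤ) : ℝ)) - Pi.single i 1 : Fin 4 → ℝ) i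
        = Int.fract ((-g) i) - (Pi.single i 1 : Fin 4 → ℝ) i := rfl
    rw [e, hngi]; simp; linarith
  · intro j hj
    have e : ∀ j, ((-g - fun j => ((⌊(-g) j⌋ : ℤ) : ℝ)) - Pi.single i 1 : Fin 4 → ℝ) j
        = Int.fract ((-g) j) - (Pi.single i 1 : Fin 4 → ℝ) j := fun j => rfl
    rw [e, e, hngi]
    simp only [Pi.single_eq_same, Pi.single_eq_of_ne hj]
    have h1 := s1 j
    refine ⟨?_, by have := Int.fract_lt_one ((-g) j); linarith⟩
    obtain ⟨k, hk⟩ := hmg j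
    have h3 : (m:ℝ) * Int.fract ((-g) j) = ((-k - m * ⌊(-g) j⌋ : ℤ) : ℝ) := by
      push_cast
      have e3 : Int.fract ((-g) j) = - g j - ⌊(-g) j⌋ := rfl
      rw [← hk, e3]; ring
    have h4 : 0 < (-k - m * ⌊(-g) j⌋ : ℤ) := by
      have : (0:ℝ) < ((-k - m * ⌊(-g) j⌋ : ℤ) : ℝ) := by rw [← h3]; positivity
      exact_mod_cast this
    have h5 : (1:ℝ) ≤ m * Int.fract ((-g) j) := by rw [h3]; exact_mod_cast h4
    have h6 : m * g i ≤ m * Int.fract ((-g) j) := by rw [hm]; exact h5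
    have h7 := le_of_mul_le_mul_left h6 hmpos
    linarith

theorem slab (u : Fin 4 → ℝ) (hu : ∀ j, 0 ≤ u j ∧ u j ≤ 1) :
    ∃ i0, ∀ i, i ≠ i0 → ∀ b : Fin 4 → ℝ, ∑ j, b j = 1 → b i ≤ 0 →
      (∀ j, j ≠ i → 0 ≤ b j + b i) → 0 ≤ ∑ j, b j * u j ∧ ∑ j, b j * u j ≤ 1 := by
  have key : ∃ i0, ∀ i, i ≠ i0 → 0 ≤ ∑ j, u j - 2 * u i ∧ ∑ j, u j - 2 * u i ≤ 2 := by
    by_contra hcon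
    push Not at hcon
    obtain ⟨i, -, hi⟩ := hcon 0
    obtain ⟨j, hji, hj⟩ := hcon i
    have h0 := hu 0
    have h1 := hu 1
    have h2 := hu 2
    have h3 := hu 3
    rw [Fin.sum_univ_four] at hi hj
    by_cases hi' : 0 ≤ u 0 + u 1 + u 2 + u 3 - 2 * u i
    · have hi'' := hi hi'
      by_cases hj' : 0 ≤ u 0 + u 1 + u 2 + u 3 - 2 * u j
      · have hj'' := hj hj'
        fin_cases i <;> fin_cases j <;> simp at hji hi'' hj'' <;> linarith
      · linarith [hu i, hu j, (hu i).1, (hu i).2, (hu j).1, (hu j).2]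
    · by_cases hj' : 0 ≤ u 0 + u 1 + u 2 + u 3 - 2 * u j
      · have hj'' := hj hj'
        linarith [(hu i).1, (hu i).2, (hu j).1, (hu j).2]
      · fin_cases i <;> fin_cases j <;> simp at hji hi' hj' <;> linarith
  obtain ⟨i0, h⟩ := key
  refine ⟨i0, fun i hi b hb hbi hbj => ?_⟩
  obtain ⟨h1, h2⟩ := h i hi
  have e : ∑ j, b j * u j = ∑ j ∈ Finset.univ.erase i, (b j + b i) * u j
      + (- b i) * (∑ j, u j - 2 * u i) := by
    have a1 := Finset.sum_erase_add Finset.univ (fun j => (b j + b i) * u j) (Finset.mem_univ i)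
    have a2 : ∑ j, (b j + b i) * u j = ∑ j, b j * u j + b i * ∑ j, u j := by
      simp [add_mul, Finset.sum_add_distrib, Finset.mul_sum]
    linarith
  have e2 : ∑ j ∈ Finset.univ.erase i, (b j + b i) = 1 + 2 * b i := by
    have a1 := Finset.sum_erase_add Finset.univ (fun j => (b j + b i)) (Finset.mem_univ i)
    have a2 : ∑ j, (b j + b i) = 1 + 4 * b i := by
      simp [Finset.sum_add_distrib, hb]
    linarith
  have l1 : 0 ≤ ∑ j ∈ Finset.univ.erase i, (b j + b i) * u j :=
    Finset.sum_nonneg fun j hj => mul_nonneg (hbj j (Finset.ne_of_mem_erase hj)) (hu j).1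
  have l2 : ∑ j ∈ Finset.univ.erase i, (b j + b i) * u j ≤ 1 + 2 * b i := by
    rw [← e2]
    exact Finset.sum_le_sum fun j hj =>
      mul_le_of_le_one_right (hbj j (Finset.ne_of_mem_erase hj)) (hu j).2
  rw [e]
  constructor <;> nlinarith

def homM (p : Fin 4 → Fin 3 → ℤ) : Matrix (Fin 4) (Fin 4) ℤ :=
  Matrix.of fun j => ![1, p j 0, p j 1, p j 2]

def homR (p : Fin 4 → Fin 3 → ℤ) : Matrix (Fin 4) (Fin 4) ℝ := (Int.castRingHom ℝ).mapMatrix (homM p)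

theorem homR_det (p : Fin 4 → Fin 3 → ℤ) : (homR p).det = ((homM p).det : ℝ) :=
  ((Int.castRingHom ℝ).map_det (homM p)).symm

theorem homM_det (p : Fin 4 → Fin 3 → ℤ) :
    (homM p).det = (Matrix.of ![p 1 - p 0, p 2 - p 0, p 3 - p 0]).det := by
  rw [Matrix.det_fin_three]
  simp [homM, Matrix.det_succ_row_zero, Fin.sum_univ_succ, Fin.succAbove]
  ring

def HH (p : Fin 4 → Fin 3 → ℤ) : AddSubgroup (Fin 4 → ℝ) where
  carrier := {b | ∃ z : Fin 4 → ℤ, Matrix.vecMul b (homR p) = fun k => (z k : ℝ)}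
  zero_mem' := ⟨0, by ext; simp⟩
  add_mem' := by
    rintro a b ⟨z, hz⟩ ⟨y, hy⟩
    refine ⟨z + y, ?_⟩
    rw [Matrix.add_vecMul, hz, hy]
    ext k; simp
  neg_mem' := by
    rintro a ⟨z, hz⟩
    refine ⟨-z, ?_⟩
    rw [Matrix.neg_vecMul, hz]
    ext k; simp

theorem vecMul_cast (n : Fin 4 → ℤ) (M : Matrix (Fin 4) (Fin 4) ℤ) :
    Matrix.vecMul (fun j => (n j : ℝ)) ((Int.castRingHom ℝ).mapMatrix M) =
      fun k => ((Matrix.vecMul n M k : ℤ) : ℝ) := by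
  ext k
  simp [Matrix.vecMul, dotProduct]

theorem stepB (p : Fin 4 → Fin 3 → ℤ) (h0 : (homM p).det ≠ 0) (h1 : (homM p).det.natAbs ≠ 1)
    (l : Fin 4 → Fin 3 → ℝ) (hl : ∀ j k, 0 ≤ l j k ∧ l j k ≤ 1) :
    ∃ b : Fin 4 → ℝ, ∑ j, b j = 1 ∧ (∀ j, b j < 1) ∧
      (∃ y : Fin 3 → ℤ, ∀ k, ∑ j, b j * (p j k : ℝ) = y k) ∧
      ∀ k, 0 ≤ ∑ j, b j * l j k ∧ ∑ j, b j * l j k ≤ 1 := by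
  have hdR : (homR p).det ≠ 0 := by rw [homR_det]; exact_mod_cast h0
  have hunit : IsUnit (homR p).det := isUnit_iff_ne_zero.2 hdR
  have hex : ∃ b ∈ HH p, ∃ j, Int.fract (b j) ≠ 0 := by
    by_contra hcon
    push Not at hcon
    apply h1
    have hsurj : Function.Surjective (fun v => Matrix.vecMul v (homM p)) := by
      intro z
      set b : Fin 4 → ℝ := Matrix.vecMul (fun k => (z k : ℝ)) (homR p)⁻¹ with hb
      have hbz : Matrix.vecMul b (homR p) = fun k => (z k : ℝ) := by
        rw [hb, Matrix.vecMul_vecMul, Matrix.nonsing_inv_mul _ hunit, Matrix.vecMul_one]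
      have hbH : b ∈ HH p := ⟨z, hbz⟩
      have hf := hcon b hbH
      have hbi : b = fun j => ((⌊b j⌋ : ℤ) : ℝ) := by
        ext j
        have := hf j
        rw [Int.fract] at this
        linarith
      refine ⟨fun j => ⌊b j⌋, ?_⟩
      rw [hbi] at hbz
      unfold homR at hbz
      rw [vecMul_cast] at hbz
      ext k
      have := congrFun hbz k
      exact_mod_cast this
    have hu : IsUnit (homM p) := Matrix.vecMul_surjective_iff_isUnit.1 hsurj
    have := (Matrix.isUnit_iff_isUnit_det _).1 hu
    exact Int.isUnit_iff_natAbs_eq.1 this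
  obtain ⟨b0, hb0, j0, hj0⟩ := hex
  have hsum : ∀ b : Fin 4 → ℝ, Matrix.vecMul b (homR p) 0 = ∑ j, b j := by
    intro b
    simp [Matrix.vecMul, dotProduct, homR, homM]
  have hcoord : ∀ (b : Fin 4 → ℝ) (k : Fin 3), Matrix.vecMul b (homR p) k.succ = ∑ j, b j * (p j k : ℝ) := by
    intro b k
    fin_cases k <;> simp [Matrix.vecMul, dotProduct, homR, homM]
  have hA := lemA (HH p) (fun n => ⟨_, vecMul_cast n (homM p)⟩)
    (by
      rintro b ⟨z, hz⟩
      exact ⟨z 0, by rw [← hsum, hz]⟩)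
    (homM p).det h0
    (by
      rintro b ⟨z, hz⟩ j
      have e := congrArg (fun t => Matrix.vecMul t (homR p).adjugate) hz
      simp only [Matrix.vecMul_vecMul, Matrix.mul_adjugate, Matrix.vecMul_smul, Matrix.vecMul_one] at e
      unfold homR at e
      rw [← RingHom.map_adjugate, vecMul_cast] at e
      have e2 := congrFun e j
      exact ⟨Matrix.vecMul z (homM p).adjugate j, by rw [← homR_det]; exact e2⟩)
    b0 hb0 j0 hj0
  have fin : ∀ b ∈ HH p, ∃ y : Fin 3 → ℤ, ∀ k, ∑ j, b j * (p j k : ℝ) = y k := by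
    rintro b ⟨z, hz⟩
    refine ⟨fun k => z k.succ, fun k => ?_⟩
    rw [← hcoord, hz]
  rcases hA with ⟨b, hb, hb1, hb2⟩ | hA
  · refine ⟨b, hb1, fun j => (hb2 j).2, fin b hb, fun k => ⟨?_, ?_⟩⟩
    · exact Finset.sum_nonneg fun j _ => mul_nonneg (hb2 j).1 (hl j k).1
    · rw [← hb1]
      exact Finset.sum_le_sum fun j _ => mul_le_of_le_one_right (hb2 j).1 (hl j k).2
  · have hsl := fun k => slab (fun j => l j k) (fun j => hl j k)
    choose bad hbad using hsl
    obtain ⟨i, hi⟩ : ∃ i : Fin 4, ∀ k, i ≠ bad k := by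
      by_contra hcon
      push Not at hcon
      have hsj : Function.Surjective bad := fun i => by
        obtain ⟨k, hk⟩ := hcon i
        exact ⟨k, hk.symm⟩
      have := Fintype.card_le_of_surjective bad hsj
      simp at this
    obtain ⟨b, hb, hb1, hbi, hbj⟩ := hA i
    refine ⟨b, hb1, fun j => ?_, fin b hb, fun k => ?_⟩
    · by_cases h : j = i
      · subst h; linarith
      · exact (hbj j h).2
    · exact hbad k i (hi k) b hb1 hbi (fun j hj => (hbj j hj).1)

theorem para_convex (v a₁ a₂ a₃ : Fin 3 → ℤ) : Convex ℝ (Parallelepiped3 v a₁ a₂ a₃) := by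
  rintro x ⟨l1, l2, l3, ⟨h1, h1'⟩, ⟨h2, h2'⟩, ⟨h3, h3'⟩, rfl⟩ y
    ⟨m1, m2, m3, ⟨g1, g1'⟩, ⟨g2, g2'⟩, ⟨g3, g3'⟩, rfl⟩ s t hs ht hst
  have ht' : t = 1 - s := by linarith
  refine ⟨s * l1 + t * m1, s * l2 + t * m2, s * l3 + t * m3, ⟨by positivity, ?_⟩,
    ⟨by positivity, ?_⟩, ⟨by positivity, ?_⟩, ?_⟩
  · nlinarith
  · nlinarith
  · nlinarith
  · subst ht'
    module

theorem descent (v a₁ a₂ a₃ : Fin 3 → ℤ) (x : Fin 3 → ℝ) : ∀ n : ℕ, ∀ p : Fin 4 → Fin 3 → ℤ,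
    (homM p).det.natAbs = n → n ≠ 0 → (∀ j, toR3 (p j) ∈ Parallelepiped3 v a₁ a₂ a₃) →
    (∃ w : Fin 4 → ℝ, (∀ j, 0 ≤ w j) ∧ ∑ j, w j = 1 ∧ x = ∑ j, w j • toR3 (p j)) →
    ∃ S, IsUnimodularTet S ∧ S ⊆ Parallelepiped3 v a₁ a₂ a₃ ∧ x ∈ S := by
  intro n
  induction n using Nat.strong_induction_on with
  | _ n ih =>
  intro p hn hn0 hP ⟨w, hw, hw1, hx⟩
  by_cases hone : n = 1
  · refine ⟨_, ⟨p, rfl, ?_⟩, ?_, ?_⟩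
    · rw [← homM_det]
      rw [hone] at hn
      simpa [Int.natAbs_eq_iff] using hn
    · apply convexHull_min _ (para_convex v a₁ a₂ a₃)
      rintro z (rfl | rfl | rfl | rfl)
      exacts [hP 0, hP 1, hP 2, hP 3]
    · rw [hx]
      refine (convex_convexHull ℝ _).sum_mem (fun j _ => hw j) hw1 (fun j _ => subset_convexHull ℝ _ ?_)
      fin_cases j <;> simp
  · have hd0 : (homM p).det ≠ 0 := by
      intro h; rw [h] at hn; simp at hn; exact hn0 hn.symm
    choose l1 l2 l3 hl1 hl2 hl3 hl using hP
    obtain ⟨b, hb1, hblt, ⟨y, hy⟩, hyP⟩ := stepB p hd0 (by rw [hn]; exact hone)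
      (fun j => ![l1 j, l2 j, l3 j])
      (by
        intro j k
        fin_cases k
        · exact hl1 j
        · exact hl2 j
        · exact hl3 j)
    have hyR : toR3 y = ∑ j, b j • toR3 (p j) := by
      ext k
      simp [toR3, hy]
    have hymem : toR3 y ∈ Parallelepiped3 v a₁ a₂ a₃ := by
      refine ⟨∑ j, b j * l1 j, ∑ j, b j * l2 j, ∑ j, b j * l3 j, hyP 0, hyP 1, hyP 2, ?_⟩
      rw [hyR]
      have : toR3 v = (∑ j, b j) • toR3 v := by rw [hb1, one_smul]
      rw [this]
      simp only [hl, Finset.sum_smul, ← Finset.sum_add_distrib]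
      refine Finset.sum_congr rfl fun j _ => ?_
      module
    obtain ⟨i, hi, himin⟩ := Finset.exists_min_image (Finset.univ.filter fun j => 0 < b j)
      (fun j => w j / b j) (by
        by_contra h
        rw [Finset.not_nonempty_iff_eq_empty, Finset.filter_eq_empty_iff] at h
        have : ∑ j, b j ≤ 0 := Finset.sum_nonpos fun j hj => not_lt.1 (h hj)
        linarith)
    have hbi : 0 < b i := by simpa using hi
    set t := w i / b i with ht
    have ht0 : 0 ≤ t := div_nonneg (hw i) hbi.le
    have hti : w i - t * b i = 0 := by rw [ht]; field_simp; ring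
    have hpos : ∀ j, 0 ≤ w j - t * b j := by
      intro j
      by_cases hj : 0 < b j
      · have := himin j (by simpa using hj)
        rw [le_div_iff₀ hj] at this
        linarith
      · have := mul_nonpos_of_nonneg_of_nonpos ht0 (not_lt.1 hj)
        linarith [hw j]
    have hdet : (homR (Function.update p i y)).det = b i * (homR p).det := by
      have e : homR (Function.update p i y) = (homR p).updateRow i (∑ j, b j • (homR p) j) := by
        ext r c
        by_cases hr : r = i
        · subst hr
          rw [Matrix.updateRow_self]
          have y0 := hy 0
          have y1 := hy 1
          have y2 := hy 2
          fin_cases c <;> simp [homR, homM, hb1, y0, y1, y2]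
        · rw [Matrix.updateRow_ne hr]
          simp [homR, homM, hr]
      rw [e, Matrix.det_updateRow_sum]
      rfl
    have hdetabs : ((homM (Function.update p i y)).det.natAbs : ℝ) = b i * n := by
      rw [← hn, Nat.cast_natAbs, Nat.cast_natAbs, Int.cast_abs, Int.cast_abs, ← homR_det, ← homR_det,
        hdet, abs_mul, abs_of_pos hbi]
    have hnpos : (0:ℝ) < n := by exact_mod_cast Nat.pos_of_ne_zero hn0
    refine ih _ ?_ (Function.update p i y) rfl ?_ ?_ ?_
    · have : ((homM (Function.update p i y)).det.natAbs : ℝ) < n := by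
        rw [hdetabs]
        nlinarith [hblt i]
      exact_mod_cast this
    · have : (0:ℝ) < ((homM (Function.update p i y)).det.natAbs : ℝ) := by
        rw [hdetabs]; positivity
      have : 0 < (homM (Function.update p i y)).det.natAbs := by exact_mod_cast this
      omega
    · intro j
      by_cases hj : j = i
      · subst hj; simpa using hymem
      · simp only [Function.update_of_ne hj]
        exact ⟨l1 j, l2 j, l3 j, hl1 j, hl2 j, hl3 j, hl j⟩
    · refine ⟨Function.update (fun j => w j - t * b j) i t, ?_, ?_, ?_⟩
      · intro j
        by_cases hj : j = i
        · subst hj; simpa using ht0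
        · simpa [Function.update_of_ne hj] using hpos j
      · rw [← Finset.add_sum_erase _ _ (Finset.mem_univ i), Function.update_self]
        have e1 : ∑ j ∈ Finset.univ.erase i, Function.update (fun j => w j - t * b j) i t j
            = ∑ j ∈ Finset.univ.erase i, (w j - t * b j) :=
          Finset.sum_congr rfl fun j hj => by
            rw [Function.update_of_ne (Finset.ne_of_mem_erase hj)]
        have e2 := Finset.add_sum_erase Finset.univ (fun j => w j - t * b j) (Finset.mem_univ i)
        have e3 : ∑ j, (w j - t * b j) = 1 - t := by
          rw [Finset.sum_sub_distrib, ← Finset.mul_sum, hw1, hb1]; ring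
        rw [e1]
        linarith
      · rw [← Finset.add_sum_erase _ _ (Finset.mem_univ i), Function.update_self, Function.update_self]
        have e1 : ∑ j ∈ Finset.univ.erase i, Function.update (fun j => w j - t * b j) i t j •
              toR3 (Function.update p i y j)
            = ∑ j ∈ Finset.univ.erase i, (w j - t * b j) • toR3 (p j) :=
          Finset.sum_congr rfl fun j hj => by
            rw [Function.update_of_ne (Finset.ne_of_mem_erase hj),
              Function.update_of_ne (Finset.ne_of_mem_erase hj)]
        have e2 := Finset.add_sum_erase Finset.univ (fun j => (w j - t * b j) • toR3 (p j))
          (Finset.mem_univ i)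
        simp only [hti, zero_smul, zero_add] at e2
        rw [e1, e2, hyR, hx, Finset.smul_sum, ← Finset.sum_add_distrib]
        refine Finset.sum_congr rfl fun j _ => ?_
        module

theorem para_swap12 (v a₁ a₂ a₃ : Fin 3 → ℤ) :
    Parallelepiped3 v a₁ a₂ a₃ = Parallelepiped3 v a₂ a₁ a₃ := by
  ext x
  constructor <;>
  · rintro ⟨l1, l2, l3, h1, h2, h3, rfl⟩
    exact ⟨l2, l1, l3, h2, h1, h3, by module⟩

theorem para_swap23 (v a₁ a₂ a₃ : Fin 3 → ℤ) :
    Parallelepiped3 v a₁ a₂ a₃ = Parallelepiped3 v a₁ a₃ a₂ := by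
  ext x
  constructor <;>
  · rintro ⟨l1, l2, l3, h1, h2, h3, rfl⟩
    exact ⟨l1, l3, l2, h1, h3, h2, by module⟩

theorem kuhn (v a₁ a₂ a₃ : Fin 3 → ℤ) (hd : (Matrix.of ![a₁, a₂, a₃]).det ≠ 0)
    (l1 l2 l3 : ℝ) (h1 : l1 ≤ 1) (h12 : l2 ≤ l1) (h23 : l3 ≤ l2) (h3 : 0 ≤ l3) :
    ∃ S, IsUnimodularTet S ∧ S ⊆ Parallelepiped3 v a₁ a₂ a₃ ∧
      toR3 v + l1 • toR3 a₁ + l2 • toR3 a₂ + l3 • toR3 a₃ ∈ S := by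
  refine descent v a₁ a₂ a₃ _ _ ![v, v + a₁, v + a₁ + a₂, v + a₁ + a₂ + a₃] rfl ?_ ?_ ?_
  · rw [homM_det, Int.natAbs_ne_zero]
    convert hd using 1
    rw [Matrix.det_fin_three, Matrix.det_fin_three]
    simp
    ring
  · intro j
    fin_cases j
    · exact ⟨0, 0, 0, by simp, by simp, by simp, by ext k; simp [toR3]⟩
    · exact ⟨1, 0, 0, by simp, by simp, by simp, by ext k; simp [toR3]⟩
    · exact ⟨1, 1, 0, by simp, by simp, by simp, by ext k; simp [toR3]⟩
    · exact ⟨1, 1, 1, by simp, by simp, by simp, by ext k; simp [toR3]⟩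
  · refine ⟨![1 - l1, l1 - l2, l2 - l3, l3], ?_, ?_, ?_⟩
    · intro j
      fin_cases j <;> simp <;> linarith
    · simp [Fin.sum_univ_four]
    · ext k
      simp [Fin.sum_univ_four, toR3]
      ring

theorem det_swap12 (a b c : Fin 3 → ℤ) (h : (Matrix.of ![a, b, c]).det ≠ 0) :
    (Matrix.of ![b, a, c]).det ≠ 0 := by
  intro h'
  apply h
  rw [Matrix.det_fin_three] at *
  simp at *
  linarith

theorem det_swap23 (a b c : Fin 3 → ℤ) (h : (Matrix.of ![a, b, c]).det ≠ 0) :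
    (Matrix.of ![a, c, b]).det ≠ 0 := by
  intro h'
  apply h
  rw [Matrix.det_fin_three] at *
  simp at *
  linarith

theorem kuhn2 (v a₁ a₂ a₃ : Fin 3 → ℤ) (hd : (Matrix.of ![a₁, a₂, a₃]).det ≠ 0)
    (l1 l2 l3 : ℝ) (h1 : l1 ≤ 1) (h12 : l2 ≤ l1) (h13 : l3 ≤ l1) (h2 : 0 ≤ l2) (h3 : 0 ≤ l3) :
    ∃ S, IsUnimodularTet S ∧ S ⊆ Parallelepiped3 v a₁ a₂ a₃ ∧
      toR3 v + l1 • toR3 a₁ + l2 • toR3 a₂ + l3 • toR3 a₃ ∈ S := by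
  rcases le_total l3 l2 with h | h
  · exact kuhn v a₁ a₂ a₃ hd l1 l2 l3 h1 h12 h h3
  · rw [para_swap23, show toR3 v + l1 • toR3 a₁ + l2 • toR3 a₂ + l3 • toR3 a₃ =
      toR3 v + l1 • toR3 a₁ + l3 • toR3 a₃ + l2 • toR3 a₂ by module]
    exact kuhn v a₁ a₃ a₂ (det_swap23 _ _ _ hd) l1 l3 l2 h1 h13 h h2

theorem kuhn3 (v a₁ a₂ a₃ : Fin 3 → ℤ) (hd : (Matrix.of ![a₁, a₂, a₃]).det ≠ 0)
    (l1 l2 l3 : ℝ) (h1 : l1 ∈ Set.Icc (0:ℝ) 1) (h2 : l2 ∈ Set.Icc (0:ℝ) 1)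
    (h3 : l3 ∈ Set.Icc (0:ℝ) 1) :
    ∃ S, IsUnimodularTet S ∧ S ⊆ Parallelepiped3 v a₁ a₂ a₃ ∧
      toR3 v + l1 • toR3 a₁ + l2 • toR3 a₂ + l3 • toR3 a₃ ∈ S := by
  by_cases c1 : l2 ≤ l1 ∧ l3 ≤ l1
  · exact kuhn2 v a₁ a₂ a₃ hd l1 l2 l3 h1.2 c1.1 c1.2 h2.1 h3.1
  by_cases c2 : l1 ≤ l2 ∧ l3 ≤ l2
  · rw [para_swap12, show toR3 v + l1 • toR3 a₁ + l2 • toR3 a₂ + l3 • toR3 a₃ =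
      toR3 v + l2 • toR3 a₂ + l1 • toR3 a₁ + l3 • toR3 a₃ by module]
    exact kuhn2 v a₂ a₁ a₃ (det_swap12 _ _ _ hd) l2 l1 l3 h2.2 c2.1 c2.2 h1.1 h3.1
  · have c3 : l1 ≤ l3 ∧ l2 ≤ l3 := by grind
    rw [para_swap23, para_swap12, show toR3 v + l1 • toR3 a₁ + l2 • toR3 a₂ + l3 • toR3 a₃ =
      toR3 v + l3 • toR3 a₃ + l1 • toR3 a₁ + l2 • toR3 a₂ by module]
    exact kuhn2 v a₃ a₁ a₂ (det_swap12 _ _ _ (det_swap23 _ _ _ hd)) l3 l1 l2 h3.2 c3.1 c3.2 h1.1 h2.1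

/-- Every 3-dimensional lattice parallelepiped has a unimodular cover. -/
theorem parallelepiped_has_unimodular_cover
    (v a₁ a₂ a₃ : Fin 3 → ℤ)
    (h : LinearIndependent ℝ ![toR3 a₁, toR3 a₂, toR3 a₃]) :
    HasUnimodularCover (Parallelepiped3 v a₁ a₂ a₃) := by
  have hd : (Matrix.of ![a₁, a₂, a₃]).det ≠ 0 := by
    intro h0
    have hu : IsUnit (Matrix.of ![toR3 a₁, toR3 a₂, toR3 a₃]) :=
      Matrix.linearIndependent_rows_iff_isUnit.1 h
    have hu2 := ((Matrix.isUnit_iff_isUnit_det _).1 hu).ne_zero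
    apply hu2
    have h1 : ((Matrix.of ![a₁, a₂, a₃]).det : ℝ) = 0 := by exact_mod_cast h0
    rw [Matrix.det_fin_three] at *
    simp [toR3] at *
    linarith
  refine ⟨{S | IsUnimodularTet S ∧ S ⊆ Parallelepiped3 v a₁ a₂ a₃}, fun S hS => hS, ?_⟩
  apply Set.Subset.antisymm
  · exact Set.sUnion_subset fun S hS => hS.2
  · rintro x ⟨l1, l2, l3, h1, h2, h3, rfl⟩
    obtain ⟨S, hS1, hS2, hx⟩ := kuhn3 v a₁ a₂ a₃ hd l1 l2 l3 h1 h2 h3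
    exact ⟨S, ⟨hS1, hS2⟩, hx⟩
end
end

section
/- Let T be an empty lattice tetrahedron in ℝ^3 that is not unimodular, with vertices p1, p2, p3, p4, and let T_1, T_2, T_3, T_4 be the corner tetrahedra of the circumscribed parallelepiped C(T). Then every T_i contains at least one lattice point of ℤ^3 different from p1, p2, p3, p4. -/
open scoped Pointwise

noncomputable section

/-- An empty lattice tetrahedron: four affinely independent lattice points whose
convex hull contains no lattice points other than its vertices. -/
def EmptyLatticeTet (p : Fin 4 → Fin 3 → ℤ) : Prop :=
  AffineIndependent ℝ (fun i => toR3 (p i)) ∧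
  ∀ z : Fin 3 → ℤ,
    toR3 z ∈ convexHull ℝ (Set.range fun i => toR3 (p i)) → ∃ i, z = p i

/-- The vertex `qᵢ = (p₁+p₂+p₃+p₄)/2 − pᵢ` of the circumscribed parallelepiped. -/
def oppVert (p : Fin 4 → Fin 3 → ℝ) (i : Fin 4) : Fin 3 → ℝ :=
  (1/2 : ℝ) • (p 0 + p 1 + p 2 + p 3) - p i

/-- The corner tetrahedron `Tᵢ = conv(qᵢ, pⱼ, pₖ, pₗ)` for `{i,j,k,l} = {1,2,3,4}`. -/
def cornerTet (p : Fin 4 → Fin 3 → ℝ) (i : Fin 4) : Set (Fin 3 → ℝ) :=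
  convexHull ℝ ({oppVert p i} ∪ p '' {j | j ≠ i})

/-- Homogenized vertex matrix. -/
def hm (p : Fin 4 → Fin 3 → ℤ) : Matrix (Fin 4) (Fin 4) ℤ :=
  Matrix.of fun j => ![1, p j 0, p j 1, p j 2]

lemma hm_det (p : Fin 4 → Fin 3 → ℤ) :
    (hm p).det = (Matrix.of ![p 1 - p 0, p 2 - p 0, p 3 - p 0]).det := by
  rw [Matrix.det_succ_row_zero]
  simp [Fin.sum_univ_succ, Matrix.det_fin_three, hm, Fin.succAbove, Matrix.submatrix]
  ring

lemma hm_det_ne (p : Fin 4 → Fin 3 → ℤ)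
    (h : AffineIndependent ℝ (fun i => toR3 (p i))) : (hm p).det ≠ 0 := by
  intro h0
  obtain ⟨w, hw, hz⟩ := Matrix.exists_vecMul_eq_zero_iff.mpr h0
  apply hw
  rw [affineIndependent_iff] at h
  have e : ∀ k, ∑ j, w j * hm p j k = 0 := fun k => congrFun hz k
  have e0 := e 0
  have e1 := e 1
  have e2 := e 2
  have e3 := e 3
  simp [hm, Fin.sum_univ_four] at e0 e1 e2 e3
  have := h Finset.univ (fun j => (w j : ℝ)) (by
    simp [Fin.sum_univ_four]; exact_mod_cast e0) (by
    ext k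
    fin_cases k <;> simp [Fin.sum_univ_four, toR3]
    · exact_mod_cast e1
    · exact_mod_cast e2
    · exact_mod_cast e3)
  ext j
  simpa using this j (Finset.mem_univ j)

/-- Abstract barycentric form. -/
lemma exists_L (p : Fin 4 → Fin 3 → ℤ) (h0 : (hm p).det ≠ 0)
    (h1 : (hm p).det ≠ 1) (h2 : (hm p).det ≠ -1) :
    ∃ (N : ℤ) (L : (Fin 4 → ℤ) →ₗ[ℤ] (Fin 4 → ℤ)), 0 < N ∧
      (∀ v, Matrix.vecMul (L v) (hm p) = N • v) ∧
      (∀ c, L (Matrix.vecMul c (hm p)) = N • c) ∧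
      (∃ v j, ¬ N ∣ L v j) := by
  set D := (hm p).det with hD
  obtain ⟨s, h3, hss⟩ : ∃ s : ℤ, s * s = 1 ∧ s * D = |D| := by
    rcases abs_cases D with h | h
    · exact ⟨1, by norm_num, by linarith⟩
    · exact ⟨-1, by norm_num, by linarith⟩
  refine ⟨|D|, s • Matrix.vecMulLinear (hm p).adjugate, abs_pos.mpr h0, ?_, ?_, ?_⟩
  · intro v
    rw [← hss]
    change Matrix.vecMul (s • Matrix.vecMul v (hm p).adjugate) (hm p) = _
    rw [Matrix.smul_vecMul, Matrix.vecMul_vecMul, Matrix.adjugate_mul, Matrix.vecMul_smul,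
      Matrix.vecMul_one, smul_smul]
  · intro v
    rw [← hss]
    change s • Matrix.vecMul (Matrix.vecMul v (hm p)) (hm p).adjugate = _
    rw [Matrix.vecMul_vecMul, Matrix.mul_adjugate, Matrix.vecMul_smul,
      Matrix.vecMul_one, smul_smul]
  · by_contra hc
    push Not at hc
    have hdiv : ∀ i j, D ∣ (hm p).adjugate i j := by
      intro i j
      have := hc (Pi.single i 1) j
      simp [Matrix.single_one_vecMul] at this
      have h4 := this.mul_left s
      rwa [← mul_assoc, h3, one_mul] at h4
    choose B hB using hdiv
    have hA : (hm p).adjugate = D • (Matrix.of B) := by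
      ext i j; simp [hB]
    have hM := Matrix.mul_adjugate (hm p)
    rw [hA, ← hD, Matrix.mul_smul] at hM
    have hM' : hm p * Matrix.of B = 1 := by
      ext i j
      have := congrFun (congrFun hM i) j
      simp only [Matrix.smul_apply, smul_eq_mul] at this
      exact mul_left_cancel₀ h0 this
    have hu := congrArg Matrix.det hM'
    rw [Matrix.det_mul, Matrix.det_one, ← hD] at hu
    rcases Int.eq_one_or_neg_one_of_mul_eq_one hu with h | h
    · exact h1 h
    · exact h2 h

lemma hm_coords (p : Fin 4 → Fin 3 → ℤ) (b v : Fin 4 → ℤ) (N : ℤ)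
    (h : Matrix.vecMul b (hm p) = N • v) :
    b 0 + b 1 + b 2 + b 3 = N * v 0 ∧
    ∀ k : Fin 3, b 0 * p 0 k + b 1 * p 1 k + b 2 * p 2 k + b 3 * p 3 k = N * v k.succ := by
  have e : ∀ k, ∑ j, b j * hm p j k = N * v k := fun k => congrFun h k
  have e0 := e 0
  have e1 := e 1
  have e2 := e 2
  have e3 := e 3
  simp [hm, Fin.sum_univ_four] at e0 e1 e2 e3
  refine ⟨e0, ?_⟩
  intro k
  fin_cases k
  · exact e1
  · exact e2
  · exact e3

lemma empty_L (p : Fin 4 → Fin 3 → ℤ) (hE : EmptyLatticeTet p)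
    (N : ℤ) (L : (Fin 4 → ℤ) →ₗ[ℤ] (Fin 4 → ℤ)) (hN : 0 < N)
    (hL1 : ∀ v, Matrix.vecMul (L v) (hm p) = N • v)
    (hL2 : ∀ c, L (Matrix.vecMul c (hm p)) = N • c)
    (v : Fin 4 → ℤ) (hpos : ∀ j, 0 ≤ L v j)
    (hsum : L v 0 + L v 1 + L v 2 + L v 3 = N) : ∃ j, L v = N • Pi.single j 1 := by
  obtain ⟨h0, hk⟩ := hm_coords p _ _ _ (hL1 v)
  have hv0 : v 0 = 1 := by
    rw [hsum] at h0
    exact mul_left_cancel₀ hN.ne' (by rw [← h0, mul_one])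
  have hNR : (0 : ℝ) < N := by exact_mod_cast hN
  obtain ⟨j, hj⟩ := hE.2 (fun k => v k.succ) (by
    have hmem : ∑ j, ((L v j : ℝ) / N) • toR3 (p j) ∈
        convexHull ℝ (Set.range fun i => toR3 (p i)) := by
      refine (convex_convexHull ℝ _).sum_mem (fun j _ => ?_) ?_ (fun j _ => ?_)
      · exact div_nonneg (by exact_mod_cast hpos j) hNR.le
      · rw [Fin.sum_univ_four]
        field_simp
        exact_mod_cast hsum
      · exact subset_convexHull ℝ _ ⟨j, rfl⟩
    convert hmem using 1
    ext k
    have hkR : (L v 0 : ℝ) * p 0 k + L v 1 * p 1 k + L v 2 * p 2 k + L v 3 * p 3 k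
        = N * v k.succ := by
      exact_mod_cast hk k
    simp only [Fin.sum_univ_four, Pi.add_apply, Pi.smul_apply, smul_eq_mul, toR3]
    field_simp
    linarith)
  refine ⟨j, ?_⟩
  rw [← hL2]
  congr 1
  rw [Matrix.single_one_vecMul]
  ext k
  refine Fin.cases ?_ (fun k => ?_) k
  · simp [hm, hv0]
  · have := congrFun hj k
    fin_cases k <;> simpa [hm] using this

/-- Residues. -/
lemma residue (p : Fin 4 → Fin 3 → ℤ) (hE : EmptyLatticeTet p)
    (N : ℤ) (L : (Fin 4 → ℤ) →ₗ[ℤ] (Fin 4 → ℤ)) (hN : 0 < N)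
    (hL1 : ∀ v, Matrix.vecMul (L v) (hm p) = N • v)
    (hL2 : ∀ c, L (Matrix.vecMul c (hm p)) = N • c)
    (v : Fin 4 → ℤ) :
    (∀ j, L v j % N = 0) ∨ ((∀ j, 0 < L v j % N) ∧
      L v 0 % N + L v 1 % N + L v 2 % N + L v 3 % N = 2 * N) := by
  have key : ∀ (v c b : Fin 4 → ℤ), (∀ j, b j = L v j + N * c j) → (∀ j, 0 ≤ b j) →
      b 0 + b 1 + b 2 + b 3 = N → ∃ j, ∀ k, b k = if k = j then N else 0 := by
    intro v c b hb hb0 hs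
    have hLb : L (v + Matrix.vecMul c (hm p)) = b := by
      rw [map_add, hL2]; ext j; simp [hb]
    obtain ⟨j, hj⟩ := empty_L p hE N L hN hL1 hL2 (v + Matrix.vecMul c (hm p))
      (by rw [hLb]; exact hb0) (by rw [hLb]; exact hs)
    refine ⟨j, fun k => ?_⟩
    rw [← hLb, hj]
    simp [Pi.single_apply]
  set r : Fin 4 → ℤ := fun j => L v j % N with hr
  have r0 : ∀ j, 0 ≤ r j := fun j => Int.emod_nonneg _ hN.ne'
  have rN : ∀ j, r j < N := fun j => Int.emod_lt_of_pos _ hN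
  have hrd : ∀ j, r j = L v j + N * (-(L v j / N)) := fun j => by
    have := Int.emod_add_mul_ediv (L v j) N
    simp only [hr]; linarith
  obtain ⟨h, hh⟩ : ∃ h, r 0 + r 1 + r 2 + r 3 = N * h := by
    obtain ⟨h0, -⟩ := hm_coords p _ _ _ (hL1 v)
    refine ⟨v 0 - (L v 0 / N) - (L v 1 / N) - (L v 2 / N) - (L v 3 / N), ?_⟩
    rw [hrd 0, hrd 1, hrd 2, hrd 3]
    linear_combination h0
  change (∀ j, r j = 0) ∨ ((∀ j, 0 < r j) ∧ r 0 + r 1 + r 2 + r 3 = 2 * N)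
  have a0 := r0 0
  have a1 := r0 1
  have a2 := r0 2
  have a3 := r0 3
  have b0 := rN 0
  have b1 := rN 1
  have b2 := rN 2
  have b3 := rN 3
  have hlo : 0 ≤ h := by
    by_contra hneg
    nlinarith
  have hhi : h < 4 := by
    by_contra hneg
    nlinarith
  have hneg : ∀ (d : Fin 4 → ℤ), (∀ j, N * d j - r j ≥ 0) →
      (N * d 0 - r 0) + (N * d 1 - r 1) + (N * d 2 - r 2) + (N * d 3 - r 3) = N →
      ∃ j, ∀ k, N * d k - r k = if k = j then N else 0 := by
    intro d hd hs
    refine key (-v) (fun j => d j + L v j / N) _ (fun j => ?_) hd hs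
    rw [hrd j]; simp; ring
  interval_cases h
  · left
    intro j
    fin_cases j <;> simp <;> linarith
  · obtain ⟨j, hj⟩ := key v _ r hrd r0 (by linarith)
    have := hj j
    have := rN j
    simp_all
  · right
    refine ⟨?_, by linarith⟩
    by_contra hc
    push Not at hc
    obtain ⟨j, hj⟩ := hc
    have hj0 : r j = 0 := le_antisymm hj (r0 j)
    obtain ⟨k, hk⟩ := hneg (fun k => if k = j then 0 else 1) (fun k => by
      by_cases e : k = j
      · subst e; simp [hj0]
      · have := rN k
        simp [e]; linarith) (by
      fin_cases j <;> simp at hj0 ⊢ <;> linarith)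
    obtain ⟨l, hl1, hl2⟩ : ∃ l : Fin 4, l ≠ j ∧ l ≠ k := by
      clear * -; revert j k; decide
    have := hk l
    simp [hl1, hl2] at this
    have := rN l
    linarith
  · obtain ⟨k, hk⟩ := hneg (fun _ => 1) (fun k => by
      have := rN k
      simp; linarith) (by linarith)
    obtain ⟨l, hl2⟩ : ∃ l : Fin 4, l ≠ k := exists_ne k
    have := hk l
    simp [hl2] at this
    have := rN l
    linarith

lemma exists_pt (p : Fin 4 → Fin 3 → ℤ) (hE : EmptyLatticeTet p)
    (N : ℤ) (L : (Fin 4 → ℤ) →ₗ[ℤ] (Fin 4 → ℤ)) (hN : 0 < N)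
    (hL1 : ∀ v, Matrix.vecMul (L v) (hm p) = N • v)
    (hL2 : ∀ c, L (Matrix.vecMul c (hm p)) = N • c)
    (hx : ∃ v j, ¬ N ∣ L v j) (i : Fin 4) :
    ∃ (v : Fin 4 → ℤ) (t : ℤ), 0 < t ∧ L v i = -t ∧ (∀ j, j ≠ i → t ≤ L v j) ∧
      L v 0 + L v 1 + L v 2 + L v 3 = N := by
  have hres := residue p hE N L hN hL1 hL2
  have hex : ∃ t : ℕ, 0 < t ∧ (t : ℤ) < N ∧ ∃ x, L x i % N = N - t := by
    obtain ⟨v, j, hv⟩ := hx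
    have hp : 0 < L v i % N := by
      rcases hres v with h | h
      · exact absurd (Int.dvd_of_emod_eq_zero (h j)) hv
      · exact h.1 i
    have hlt := Int.emod_lt_of_pos (L v i) hN
    refine ⟨(N - L v i % N).toNat, by omega, by omega, v, by omega⟩
  classical
  set t := Nat.find hex with ht
  obtain ⟨ht0, htN, x, hxi⟩ := Nat.find_spec hex
  rw [← ht] at ht0 htN hxi
  have hmin : ∀ u : ℕ, 0 < u → u < t → ∀ y, L y i % N ≠ N - u := by
    intro u hu0 hut y hy
    exact Nat.find_min hex hut ⟨hu0, by omega, y, hy⟩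
  have htz : (0 : ℤ) < t := by exact_mod_cast ht0
  have hxpos : (∀ j, 0 < L x j % N) ∧
      L x 0 % N + L x 1 % N + L x 2 % N + L x 3 % N = 2 * N := by
    rcases hres x with h | h
    · have := h i
      omega
    · exact h
  have hge : ∀ j, (t : ℤ) ≤ L x j % N := by
    -- n = ceil (N / t)
    set n : ℤ := -((-N) / t) with hn
    set u : ℤ := (-N) % t with hu
    have hnu : n * t = N + u := by
      have := Int.emod_add_mul_ediv (-N) t
      rw [hn, hu]; linarith
    have hu0 : 0 ≤ u := Int.emod_nonneg _ htz.ne'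
    have hut : u < t := Int.emod_lt_of_pos _ htz
    have hnpos : 0 < n := by
      by_contra hneg
      nlinarith
    have hLi : L (n • x) i = -u + N * (n * (L x i / N) + n - 1) := by
      have := Int.emod_add_mul_ediv (L x i) N
      rw [map_smul, Pi.smul_apply, smul_eq_mul]
      linear_combination (-n) * this + n * hxi - hnu
    have hu00 : u = 0 := by
      by_contra hne
      have hup : 0 < u := lt_of_le_of_ne hu0 (Ne.symm hne)
      refine hmin u.toNat (by omega) (by omega) (n • x) ?_
      rw [hLi, Int.add_mul_emod_self_left, Int.toNat_of_nonneg hu0]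
      rw [← Int.add_emod_right, Int.emod_eq_of_lt (by omega) (by omega)]
      ring
    have hz : ∀ j, L (n • x) j % N = 0 := by
      rcases hres (n • x) with h | h
      · exact h
      · have := h.1 i
        rw [hLi, hu00, Int.add_mul_emod_self_left] at this
        simp at this
    intro j
    have h1 := Int.dvd_of_emod_eq_zero (hz j)
    rw [map_smul, Pi.smul_apply, smul_eq_mul] at h1
    have h2 : N ∣ n * (L x j % N) := by
      rw [Int.emod_def, mul_sub]
      exact dvd_sub h1 ⟨n * (L x j / N), by ring⟩
    have h3 := Int.le_of_dvd (mul_pos hnpos (hxpos.1 j)) h2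
    rw [hu00, add_zero] at hnu
    have h6 : n * (t : ℤ) ≤ n * (L x j % N) := hnu.le.trans h3
    exact le_of_mul_le_mul_left h6 hnpos
  set c : Fin 4 → ℤ := fun j => -(L x j / N) - (if j = i then 1 else 0) with hc
  have hLv : ∀ j, L (x + Matrix.vecMul c (hm p)) j = L x j % N - (if j = i then N else 0) := by
    intro j
    rw [map_add, hL2, Int.emod_def]
    simp only [hc, Pi.add_apply, Pi.smul_apply, smul_eq_mul]
    split_ifs <;> ring
  refine ⟨x + Matrix.vecMul c (hm p), t, htz, ?_, ?_, ?_⟩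
  · rw [hLv]; simp; linarith
  · intro j hj
    rw [hLv]; simpa [hj] using hge j
  · simp only [hLv]
    have := hxpos.2
    fin_cases i <;> simp <;> linarith

/-- If `T` is an empty lattice tetrahedron which is not unimodular, then every
corner tetrahedron of the circumscribed parallelepiped `C(T)` contains a lattice
point different from the vertices of `T`. -/
theorem corner_tetrahedra_contain_lattice_point
    (p : Fin 4 → Fin 3 → ℤ)
    (hEmpty : EmptyLatticeTet p)
    (hNotUni : (Matrix.of ![p 1 - p 0, p 2 - p 0, p 3 - p 0]).det ∉ ({1, -1} : Set ℤ))
    (i : Fin 4) :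
    ∃ z : Fin 3 → ℤ,
      toR3 z ∈ cornerTet (fun j => toR3 (p j)) i ∧ ∀ j, z ≠ p j := by
  have hdet := hm_det p
  simp only [Set.mem_insert_iff, Set.mem_singleton_iff, not_or, ← hdet] at hNotUni
  obtain ⟨N, L, hN, hL1, hL2, hx⟩ := exists_L p (hm_det_ne p hEmpty.1) hNotUni.1 hNotUni.2
  obtain ⟨v, t, ht, hvi, hvj, hs⟩ := exists_pt p hEmpty N L hN hL1 hL2 hx i
  obtain ⟨h0, hk⟩ := hm_coords p _ _ _ (hL1 v)
  have hv0 : v 0 = 1 := by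
    rw [hs] at h0
    exact mul_left_cancel₀ hN.ne' (by rw [← h0, mul_one])
  have hNR : (0 : ℝ) < N := by exact_mod_cast hN
  have htR : (0 : ℝ) < t := by exact_mod_cast ht
  refine ⟨fun k => v k.succ, ?_, ?_⟩
  · set P : Fin 4 → Fin 3 → ℝ := fun j => toR3 (p j) with hP
    -- weights: slot `i` carries the opposite vertex
    set W : Fin 4 → ℝ := fun j => if j = i then 2 * t / N else (L v j - t) / N with hW
    set Q : Fin 4 → Fin 3 → ℝ := fun j => if j = i then oppVert P i else P j with hQ
    have hsR : (L v 0 : ℝ) + L v 1 + L v 2 + L v 3 = N := by exact_mod_cast hs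
    have hviR : (L v i : ℝ) = -t := by exact_mod_cast hvi
    have hmem : ∑ j, W j • Q j ∈ cornerTet P i := by
      refine (convex_convexHull ℝ _).sum_mem (fun j _ => ?_) ?_ (fun j _ => ?_)
      · by_cases e : j = i
        · simp only [hW, e, if_true]; positivity
        · have : (t : ℝ) ≤ L v j := by exact_mod_cast hvj j e
          simp only [hW, e, if_false]
          exact div_nonneg (by linarith) hNR.le
      · rw [Fin.sum_univ_four]
        clear_value P
        fin_cases i <;> simp [hW] at hviR ⊢ <;> field_simp <;> linarith
      · apply subset_convexHull
        by_cases e : j = i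
        · left; simp [hQ, e]
        · right; exact ⟨j, e, by simp [hQ, e]⟩
    convert hmem using 1
    ext k
    have hkR : (L v 0 : ℝ) * P 0 k + L v 1 * P 1 k + L v 2 * P 2 k + L v 3 * P 3 k
        = N * v k.succ := by
      simp only [hP, toR3]; exact_mod_cast hk k
    have hg : toR3 (fun k => v k.succ) k = (v k.succ : ℝ) := rfl
    rw [hg, ← mul_right_inj' hNR.ne', ← hkR]
    clear_value P
    rw [Fin.sum_univ_four]
    fin_cases i <;> simp [hW, hQ, oppVert] at hviR ⊢ <;> rw [hviR] <;> field_simp <;> ring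
  · intro j hj
    have hvv : v = Matrix.vecMul (Pi.single j 1) (hm p) := by
      rw [Matrix.single_one_vecMul]
      ext k
      refine Fin.cases ?_ (fun k => ?_) k
      · simp [hm, hv0]
      · have := congrFun hj k
        fin_cases k <;> simpa [hm] using this
    have h5 := congrFun (hL2 (Pi.single j 1)) i
    rw [← hvv, hvi] at h5
    simp [Pi.single_apply] at h5
    split_ifs at h5 <;> omega
end
end

section
/- Let P ⊂ ℝ^3 be a lattice 3-polytope with the circumscribed parallelepiped property, i.e., for every empty lattice tetrahedron T contained in P, at least one of the four corner tetrahedra of the circumscribed parallelepiped C(T) is contained in P. Then P has a unimodular cover. -/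
open scoped Pointwise

noncomputable section

theorem key_all (R : AddSubgroup (Fin 4 → ℤ)) (d : ℤ) (hd : 0 < d)
    (hsum : ∀ r ∈ R, d ∣ ∑ i, r i) (hv : ∀ a : Fin 4 → ℤ, d • a ∈ R)
    (he : ∀ r ∈ R, ∑ i, r i = d → (∀ i, 0 ≤ r i) → ∃ i, r = Pi.single i d)
    (r : Fin 4 → ℤ) (hr : r ∈ R) (h0 : ∀ i, 0 ≤ r i) (h1 : ∀ i, r i < d) :
    (∀ i, r i = 0) ∨ ((∀ i, 0 < r i) ∧ ∑ i, r i = 2 * d) := by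
  have he' : ∀ s ∈ R, ∑ i, s i = d → (∀ i, 0 ≤ s i) → ∃ i, s i = d ∧ ∀ j, j ≠ i → s j = 0 := by
    intro s hs h h'
    obtain ⟨i, rfl⟩ := he s hs h h'
    refine ⟨i, by simp, fun j hj => by simp [hj]⟩
  obtain ⟨n, hn⟩ := hsum r hr
  have hc : ∀ a : Fin 4 → ℤ, ∑ i, (d * a i - r i) = d → (∀ i, 0 ≤ d * a i - r i) →
      ∃ i, d * a i - r i = d ∧ ∀ j, j ≠ i → d * a j - r j = 0 := by
    intro a h h'
    exact he' (d • a - r) (R.sub_mem (hv a) hr) (by simpa using h) (by simpa using h')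
  have hS : ∑ i, r i = r 0 + r 1 + r 2 + r 3 := Fin.sum_univ_four _
  have a0 := h0 0
  have a1 := h0 1
  have a2 := h0 2
  have a3 := h0 3
  have b0 := h1 0
  have b1 := h1 1
  have b2 := h1 2
  have b3 := h1 3
  have n0 : 0 ≤ n := by nlinarith
  have n4 : n < 4 := by nlinarith
  have hn1 : n ≠ 1 := by
    rintro rfl
    obtain ⟨i, hi, -⟩ := he' r hr (by linarith) h0
    linarith [h1 i]
  have hn3 : n ≠ 3 := by
    rintro rfl
    obtain ⟨i, hi, hj⟩ := hc (fun _ => 1) (by rw [Fin.sum_univ_four]; linarith)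
      (fun i => by linarith [h1 i])
    have : ∃ j, j ≠ i := ⟨i + 1, by simp⟩
    obtain ⟨j, hji⟩ := this
    linarith [h1 j, hj j hji]
  by_cases hn0 : n = 0
  · left
    subst hn0
    intro i
    fin_cases i <;> simp <;> linarith
  have hn2 : n = 2 := by omega
  subst hn2
  right
  refine ⟨fun k => ?_, by linarith⟩
  by_contra hk
  have hk0 : r k = 0 := le_antisymm (not_lt.1 hk) (h0 k)
  obtain ⟨i, hi, hj⟩ := hc (fun j => if j = k then 0 else 1)
    (by
      have : ∑ j : Fin 4, d * (if j = k then (0:ℤ) else 1) = 3 * d := by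
        fin_cases k <;> simp [Fin.sum_univ_four] <;> ring
      rw [Finset.sum_sub_distrib, this]; linarith)
    (fun j => by
      by_cases h : j = k
      · subst h; simp [hk0]
      · simp only [h, if_false]; linarith [h1 j])
  have : ∀ i k : Fin 4, ∃ j, j ≠ i ∧ j ≠ k := by decide
  obtain ⟨j, hji, hjk⟩ := this i k
  have := hj j hji
  simp only [hjk, if_false] at this
  linarith [h1 j]

theorem key (R : AddSubgroup (Fin 4 → ℤ)) (d : ℤ) (hd : 0 < d)
    (hsum : ∀ r ∈ R, d ∣ ∑ i, r i) (hv : ∀ a : Fin 4 → ℤ, d • a ∈ R)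
    (he : ∀ r ∈ R, ∑ i, r i = d → (∀ i, 0 ≤ r i) → ∃ i, r = Pi.single i d)
    (hn : ∃ r ∈ R, ∃ i, ¬ d ∣ r i) (i : Fin 4) :
    ∃ r ∈ R, ∑ i, r i = d ∧ r i < 0 ∧ ∀ j, j ≠ i → 0 ≤ r j + r i := by
  have hmod : ∀ r ∈ R, (fun i => r i % d) ∈ R := by
    intro r hr
    have := R.sub_mem hr (hv (fun i => r i / d))
    convert this using 1
    ext i
    simp [Int.emod_def]
  have hdich : ∀ r ∈ R, (∀ i, d ∣ r i) ∨
      ((∀ i, ¬ d ∣ r i) ∧ ∑ i, r i % d = 2 * d) := by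
    intro r hr
    rcases key_all R d hd hsum hv he _ (hmod r hr) (fun i => Int.emod_nonneg _ hd.ne')
      (fun i => Int.emod_lt_of_pos _ hd) with h | ⟨h, h'⟩
    · left; exact fun i => Int.dvd_of_emod_eq_zero (h i)
    · right
      exact ⟨fun i hi => (h i).ne' (Int.emod_eq_zero_of_dvd hi), h'⟩
  obtain ⟨g0, hg0⟩ := Int.subgroup_cyclic (R.map (Pi.evalAddMonoidHom (fun _ : Fin 4 => ℤ) i))
  obtain ⟨g, hg⟩ : ∃ g : ℤ, g = |g0| := ⟨_, rfl⟩
  have hmem : ∀ t : ℤ, (∃ r ∈ R, r i = t) ↔ g ∣ t := by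
    intro t
    have : t ∈ R.map (Pi.evalAddMonoidHom (fun _ : Fin 4 => ℤ) i) ↔ g0 ∣ t := by
      rw [hg0, AddSubgroup.mem_closure_singleton]
      constructor
      · rintro ⟨n, rfl⟩; simp
      · rintro ⟨n, rfl⟩; exact ⟨n, by simp [mul_comm]⟩
    rw [hg, abs_dvd, ← this]
    simp [AddSubgroup.mem_map]
  have hgd : g ∣ d := (hmem d).1 ⟨d • Pi.single i 1, hv _, by simp⟩
  have hgpos : 0 < g := by
    have : 0 ≤ g := by rw [hg]; exact abs_nonneg _
    rcases this.lt_or_eq with h | h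
    · exact h
    · rw [← h] at hgd; have := zero_dvd_iff.1 hgd; omega
  have hndg : ¬ d ∣ g := by
    intro h
    obtain ⟨r, hr, k, hk⟩ := hn
    rcases hdich r hr with h' | ⟨h', -⟩
    · exact hk (h' k)
    · exact h' i (h.trans ((hmem _).1 ⟨r, hr, rfl⟩))
  have hglt : g < d := by
    refine lt_of_le_of_ne (Int.le_of_dvd hd hgd) ?_
    rintro rfl; exact hndg dvd_rfl
  obtain ⟨r, hr, hri⟩ := (hmem (-g)).2 (by simp)
  have hnd : ¬ d ∣ r i := by rw [hri, dvd_neg]; exact hndg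
  obtain ⟨h1, h2⟩ := (hdich r hr).resolve_left (fun h => hnd (h i))
  obtain ⟨m, hm⟩ := hgd
  have hgr : ∀ j, g ∣ r j := by
    intro j
    have hmr : d ∣ (m • r) j := by
      rcases hdich (m • r) (R.zsmul_mem hr m) with h | ⟨h, -⟩
      · exact h j
      · exfalso; apply h i
        simp only [Pi.smul_apply, smul_eq_mul, hri]
        exact ⟨-1, by rw [hm]; ring⟩
    obtain ⟨t, ht⟩ := hmr
    refine ⟨t, ?_⟩
    have hm0 : m ≠ 0 := by rintro rfl; simp at hm; omega
    simp only [Pi.smul_apply, smul_eq_mul] at ht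
    apply mul_left_cancel₀ hm0
    rw [ht, hm]; ring
  have hri' : r i % d = d - g := by
    rw [hri, ← Int.add_emod_right, Int.emod_eq_of_lt] <;> linarith
  have hre : ∀ j, g ≤ r j % d := by
    intro j
    have hg' : g ∣ r j % d := by
      rw [Int.emod_def]
      exact dvd_sub (hgr j) (dvd_mul_of_dvd_left ⟨m, hm⟩ _)
    refine Int.le_of_dvd ?_ hg'
    refine lt_of_le_of_ne (Int.emod_nonneg _ hd.ne') ?_
    intro h
    exact h1 j (Int.dvd_of_emod_eq_zero h.symm)
  refine ⟨(fun i => r i % d) - d • Pi.single i 1, R.sub_mem (hmod r hr) (hv _), ?_, ?_, ?_⟩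
  · simp [Finset.sum_sub_distrib, h2, ← Finset.mul_sum]; ring
  · simp [hri', hgpos]
  · intro j hj
    simp [hj, hri']; linarith [hre j]

theorem mem_hull_range {n : ℕ} (v : Fin n → Fin 3 → ℝ) (x : Fin 3 → ℝ) :
    x ∈ convexHull ℝ (Set.range v) ↔
      ∃ w : Fin n → ℝ, (∀ i, 0 ≤ w i) ∧ ∑ i, w i = 1 ∧ ∑ i, w i • v i = x := by
  constructor
  · intro hx
    have : convexHull ℝ (Set.range v) ⊆ {x | ∃ w : Fin n → ℝ, (∀ i, 0 ≤ w i) ∧ ∑ i, w i = 1 ∧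
        ∑ i, w i • v i = x} := by
      apply convexHull_min
      · rintro _ ⟨i, rfl⟩
        refine ⟨Pi.single i 1, fun j => ?_, by simp, ?_⟩
        · by_cases h : j = i
          · subst h; simp
          · simp [h]
        · simp [Pi.single_apply, ite_smul]
      · rintro x ⟨w, h0, h1, rfl⟩ y ⟨w', h0', h1', rfl⟩ a b ha hb hab
        refine ⟨a • w + b • w', fun i => ?_, ?_, ?_⟩
        · simp only [Pi.add_apply, Pi.smul_apply, smul_eq_mul]
          have := h0 i
          have := h0' i
          positivity
        · simp [Finset.sum_add_distrib, ← Finset.mul_sum, h1, h1', hab]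
        · simp [Finset.sum_add_distrib, Finset.smul_sum, add_smul, mul_smul]
    exact this hx
  · rintro ⟨w, h0, h1, h2⟩
    exact mem_convexHull_of_exists_fintype w v h0 h1 (fun i => ⟨i, rfl⟩) h2

/-- homogenized matrix -/
def hmat (p : Fin 4 → Fin 3 → ℤ) : Matrix (Fin 4) (Fin 4) ℤ :=
  Matrix.of fun i => Matrix.vecCons 1 (p i)

theorem hmat_det (p : Fin 4 → Fin 3 → ℤ) :
    (Matrix.of ![p 1 - p 0, p 2 - p 0, p 3 - p 0]).det = (hmat p).det := by
  simp [hmat, Matrix.det_succ_row_zero, Fin.sum_univ_succ, Fin.succAbove]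
  ring

theorem exists_B (p : Fin 4 → Fin 3 → ℤ) :
    ∃ B : Matrix (Fin 4) (Fin 4) ℤ, hmat p * B = |(hmat p).det| • 1 ∧
      B * hmat p = |(hmat p).det| • 1 := by
  refine ⟨(hmat p).det.sign • (hmat p).adjugate, ?_, ?_⟩
  · rw [Matrix.mul_smul, Matrix.mul_adjugate, smul_smul, Int.sign_mul_self_eq_abs]
  · rw [Matrix.smul_mul, Matrix.adjugate_mul, smul_smul, Int.sign_mul_self_eq_abs]

/-- barycentric vanishing -/
theorem weights_zero (p : Fin 4 → Fin 3 → ℤ) (h : (hmat p).det ≠ 0) (w : Fin 4 → ℝ)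
    (h1 : ∑ i, w i = 0) (h2 : ∑ i, w i • toR3 (p i) = 0) : w = 0 := by
  by_contra hw
  have hdet : ((hmat p).map (Int.castRingHom ℝ)).det = 0 := by
    rw [← Matrix.exists_vecMul_eq_zero_iff]
    refine ⟨w, hw, ?_⟩
    ext k
    refine Fin.cases ?_ (fun k => ?_) k
    · simpa [Matrix.vecMul, dotProduct, hmat] using h1
    · have := congrFun h2 k
      simpa [Matrix.vecMul, dotProduct, hmat, toR3] using this
  rw [← RingHom.mapMatrix_apply, ← RingHom.map_det] at hdet
  exact h (by simpa using hdet)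

theorem affInd (p : Fin 4 → Fin 3 → ℤ) (h : (hmat p).det ≠ 0) :
    AffineIndependent ℝ (fun i => toR3 (p i)) := by
  rw [affineIndependent_iff_of_fintype]
  intro w hw h2
  rw [Finset.weightedVSub_eq_linear_combination _ hw] at h2
  exact fun i => congrFun (weights_zero p h w hw h2) i

theorem det_ne (p : Fin 4 → Fin 3 → ℤ) (h : AffineIndependent ℝ (fun i => toR3 (p i))) :
    (hmat p).det ≠ 0 := by
  intro hd
  have hdet : ((hmat p).map (Int.castRingHom ℝ)).det = 0 := by
    rw [← RingHom.mapMatrix_apply, ← RingHom.map_det, hd]; simp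
  rw [← Matrix.exists_vecMul_eq_zero_iff] at hdet
  obtain ⟨w, hw, h0⟩ := hdet
  apply hw
  ext i
  refine h.eq_zero_of_sum_eq_zero (s := Finset.univ) (w := w) ?_ ?_ i (Finset.mem_univ i)
  · have := congrFun h0 0
    simpa [Matrix.vecMul, dotProduct, hmat] using this
  · ext k
    have := congrFun h0 k.succ
    simpa [Matrix.vecMul, dotProduct, hmat, toR3] using this

theorem exists_tet (S : Set (Fin 3 → ℝ)) (hS : affineSpan ℝ S = ⊤) (x : Fin 3 → ℝ)
    (hx : x ∈ convexHull ℝ S) : ∃ q : Fin 4 → Fin 3 → ℝ, (∀ i, q i ∈ S) ∧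
      AffineIndependent ℝ q ∧ x ∈ convexHull ℝ (Set.range q) := by
  rw [convexHull_eq_union] at hx
  simp only [exists_prop, Set.mem_iUnion] at hx
  obtain ⟨t, ht1, ht2, ht3⟩ := hx
  have hne : (t : Set (Fin 3 → ℝ)).Nonempty := by
    rw [← convexHull_nonempty_iff (𝕜 := ℝ)]; exact ⟨x, ht3⟩
  obtain ⟨p, hp⟩ := hne
  have hpS := ht1 hp
  have h : AffineIndependent ℝ (fun q => q.1 : ↥(t : Set (Fin 3 → ℝ)) → Fin 3 → ℝ) := ht2
  rw [affineIndependent_set_iff_linearIndependent_vsub ℝ hp, linearIndependent_subtype_iff] at h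
  obtain ⟨b, hb2, hb1, hb3, hb4⟩ := exists_linearIndepOn_id_extension h
    (t := (fun q => q -ᵥ p) '' S) (Set.image_mono (Set.sdiff_subset.trans ht1))
  have hspan : Submodule.span ℝ b = ⊤ := by
    rw [eq_top_iff, ← AffineSubspace.direction_top ℝ (Fin 3 → ℝ) (Fin 3 → ℝ), ← hS,
      direction_affineSpan, vectorSpan_eq_span_vsub_set_right ℝ hpS]
    exact Submodule.span_le.2 hb3
  have h0 : ∀ v : Fin 3 → ℝ, v ∈ b → v ≠ 0 := fun v hv => hb4.ne_zero hv
  rw [← linearIndependent_subtype_iff,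
      linearIndependent_set_iff_affineIndependent_vadd_union_singleton ℝ h0 p] at hb4
  have htop := affineSpan_singleton_union_vadd_eq_top_of_span_eq_top (k := ℝ) p
    (s := b) (by simpa using hspan)
  set U : Set (Fin 3 → ℝ) := {p} ∪ (fun v => v +ᵥ p) '' b with hU
  have hUS : U ⊆ S := by
    rintro y (rfl | ⟨v, hv, rfl⟩)
    · exact hpS
    · obtain ⟨s, hs, rfl⟩ := hb2 hv
      simpa using hs
  have htU : (t : Set (Fin 3 → ℝ)) ⊆ U := by
    intro y hy
    by_cases hyp : y = p
    · left; exact hyp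
    · right; exact ⟨y - p, hb1 ⟨y, ⟨hy, hyp⟩, rfl⟩, by simp⟩
  have hfin : Finite U := finite_of_fin_dim_affineIndependent ℝ hb4
  have := Fintype.ofFinite U
  have hcard := hb4.affineSpan_eq_top_iff_card_eq_finrank_add_one.1 (by simpa using htop)
  rw [Module.finrank_fin_fun] at hcard
  let e := (Fintype.equivFinOfCardEq hcard).symm
  refine ⟨fun i => e i, fun i => hUS (e i).2, hb4.comp_embedding e.toEmbedding, ?_⟩
  have hr : Set.range (fun i => (e i : Fin 3 → ℝ)) = U := by
    ext y
    constructor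
    · rintro ⟨i, rfl⟩; exact (e i).2
    · intro hy; exact ⟨e.symm ⟨y, hy⟩, by simp⟩
  rw [hr]
  exact convexHull_mono htU ht3

theorem improve (p : Fin 4 → Fin 3 → ℤ) (hdet : (hmat p).det ≠ 0) (u : Fin 3 → ℤ)
    (c : Fin 4 → ℤ) (hc1 : ∑ i, c i = |(hmat p).det|)
    (hc2 : ∑ i, c i • p i = |(hmat p).det| • u)
    (x : Fin 3 → ℝ) (hx : x ∈ convexHull ℝ (Set.range fun i => toR3 (p i))) :
    ∃ l, 0 < c l ∧ |(hmat (Function.update p l u)).det| = c l ∧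
      x ∈ convexHull ℝ (Set.range fun i => toR3 (Function.update p l u i)) := by
  obtain ⟨w, hw0, hw1, hwx⟩ := (mem_hull_range _ _).1 hx
  set d := |(hmat p).det| with hd
  have hdpos : 0 < d := abs_pos.2 hdet
  have hne : (Finset.univ.filter fun i => 0 < c i).Nonempty := by
    by_contra h
    have : ∀ i, c i ≤ 0 := by
      intro i
      by_contra hi
      exact h ⟨i, by simpa using hi⟩
    have := Finset.sum_nonpos (fun i (_ : i ∈ Finset.univ) => this i)
    omega
  obtain ⟨l, hl, hmin⟩ := Finset.exists_min_image _ (fun i => w i / (c i : ℝ)) hne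
  simp only [Finset.mem_filter, Finset.mem_univ, true_and] at hl hmin
  have hlR : (0 : ℝ) < c l := by exact_mod_cast hl
  have hdR : (0 : ℝ) < d := by exact_mod_cast hdpos
  have hmat_upd : hmat (Function.update p l u) = (hmat p).updateRow l (Matrix.vecCons 1 u) := by
    ext i j
    by_cases h : i = l
    · subst h; simp [hmat]
    · simp [hmat, h]
  have hrow : d • (Matrix.vecCons 1 u : Fin 4 → ℤ) = ∑ k, c k • (hmat p) k := by
    ext j
    refine Fin.cases ?_ (fun j => ?_) j
    · simp [hmat, hc1]
    · have := congrFun hc2 j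
      simpa [hmat] using this.symm
  refine ⟨l, hl, ?_, ?_⟩
  · have h1 := Matrix.det_updateRow_sum (hmat p) l c
    rw [← hrow, Matrix.det_updateRow_smul, ← hmat_upd] at h1
    have h2 := congrArg abs h1
    simp only [smul_eq_mul, abs_mul] at h2
    rw [abs_of_pos hdpos, abs_of_pos hl, ← hd, mul_comm] at h2
    exact mul_right_cancel₀ hdpos.ne' h2
  · set s : ℝ := w l / c l with hs
    have hs0 : 0 ≤ s := div_nonneg (hw0 l) hlR.le
    have hnn : ∀ j, 0 ≤ w j - s * c j := by
      intro j
      by_cases hj : 0 < c j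
      · have hjR : (0 : ℝ) < c j := by exact_mod_cast hj
        have := hmin j hj
        rw [le_div_iff₀ hjR] at this
        linarith
      · have hjR : (c j : ℝ) ≤ 0 := by exact_mod_cast not_lt.1 hj
        have := hw0 j
        nlinarith
    have hl0 : w l - s * c l = 0 := by rw [hs]; field_simp; simp
    have hc1R : ∑ i, (c i : ℝ) = d := by exact_mod_cast hc1
    rw [mem_hull_range]
    refine ⟨fun j => (w j - s * c j) + Pi.single (M := fun _ => ℝ) l (s * d) j, fun j => ?_, ?_, ?_⟩
    · have : 0 ≤ Pi.single (M := fun _ => ℝ) l (s * d) j := by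
        by_cases h : j = l
        · subst h; simp; positivity
        · simp [h]
      linarith [hnn j]
    · simp [Finset.sum_add_distrib, Finset.sum_sub_distrib, ← Finset.mul_sum, hw1, hc1R]
    · have e1 : ∀ j, ((w j - s * c j) + Pi.single (M := fun _ => ℝ) l (s * d) j) •
          toR3 (Function.update p l u j) = (w j - s * c j) • toR3 (p j) +
            Pi.single (M := fun _ => ℝ) l (s * d) j • toR3 u := by
        intro j
        by_cases h : j = l
        · subst h; simp [hl0]
        · simp [h]
      simp only [e1]
      rw [Finset.sum_add_distrib, ← hwx]
      ext k
      have := congrFun hc2 k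
      simp only [Finset.sum_apply, Pi.smul_apply, smul_eq_mul] at this
      have hR : ∑ i, (c i : ℝ) * (p i k : ℝ) = d * u k := by exact_mod_cast this
      simp only [sub_smul, Finset.sum_sub_distrib, Pi.add_apply, Pi.sub_apply, Finset.sum_apply,
        Pi.smul_apply, smul_eq_mul, toR3, ← Finset.sum_mul, mul_assoc, ← Finset.mul_sum, hR]
      simp [mul_assoc]

theorem coords (p : Fin 4 → Fin 3 → ℤ) (B : Matrix (Fin 4) (Fin 4) ℤ) (d : ℤ)
    (hB : B * hmat p = d • 1) (y : Fin 4 → ℤ) :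
    ∑ i, (Matrix.vecMul y B) i = d * y 0 ∧
    ∑ i, (Matrix.vecMul y B) i • p i = d • (fun k : Fin 3 => y k.succ) := by
  have h : Matrix.vecMul (Matrix.vecMul y B) (hmat p) = d • y := by
    rw [Matrix.vecMul_vecMul, hB]; simp
  constructor
  · have := congrFun h 0
    simpa [Matrix.vecMul, dotProduct, hmat] using this
  · ext k
    have := congrFun h k.succ
    simpa [Matrix.vecMul, dotProduct, hmat] using this

theorem sum_real (p : Fin 4 → Fin 3 → ℤ) (c : Fin 4 → ℤ) (d : ℤ) (hd : 0 < d) (u : Fin 3 → ℤ)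
    (hc2 : ∑ i, c i • p i = d • u) : ∑ i, ((c i : ℝ) / d) • toR3 (p i) = toR3 u := by
  ext k
  have := congrFun hc2 k
  simp only [Finset.sum_apply, Pi.smul_apply, smul_eq_mul] at this
  have hR : ∑ i, (c i : ℝ) * (p i k : ℝ) = d * u k := by exact_mod_cast this
  have hdR : (d : ℝ) ≠ 0 := by exact_mod_cast hd.ne'
  simp only [Finset.sum_apply, Pi.smul_apply, smul_eq_mul, toR3, div_mul_eq_mul_div,
    ← Finset.sum_div, hR]
  field_simp

theorem sum_real_one (c : Fin 4 → ℤ) (d : ℤ) (hd : 0 < d) (hc1 : ∑ i, c i = d) :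
    ∑ i, ((c i : ℝ) / d) = 1 := by
  have hR : ∑ i, (c i : ℝ) = d := by exact_mod_cast hc1
  have hdR : (d : ℝ) ≠ 0 := by exact_mod_cast hd.ne'
  rw [← Finset.sum_div, hR, div_self hdR]

theorem exists_corner (p : Fin 4 → Fin 3 → ℤ) (hE : EmptyLatticeTet p)
    (hdet : 1 < |(hmat p).det|) (i : Fin 4) :
    ∃ (u : Fin 3 → ℤ) (c : Fin 4 → ℤ), ∑ i, c i = |(hmat p).det| ∧
      ∑ i, c i • p i = |(hmat p).det| • u ∧ c i < 0 ∧ ∀ j, j ≠ i → 0 ≤ c j + c i := by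
  obtain ⟨B, hB1, hB2⟩ := exists_B p
  set d := |(hmat p).det| with hd
  have hdpos : 0 < d := by omega
  let R : AddSubgroup (Fin 4 → ℤ) := (Matrix.vecMulLinear B).toAddMonoidHom.range
  have hR : ∀ r, r ∈ R ↔ ∃ y, Matrix.vecMul y B = r := fun r => Iff.rfl
  suffices hk : ∃ r ∈ R, ∑ i, r i = d ∧ r i < 0 ∧ ∀ j, j ≠ i → 0 ≤ r j + r i by
    obtain ⟨r, hr, h1, h2, h3⟩ := hk
    obtain ⟨y, rfl⟩ := (hR r).1 hr
    obtain ⟨ha, hb⟩ := coords p B d hB2 y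
    exact ⟨_, _, h1, hb, h2, h3⟩
  refine key R d hdpos ?_ ?_ ?_ ?_ i
  · intro r hr
    obtain ⟨y, rfl⟩ := (hR r).1 hr
    exact ⟨_, (coords p B d hB2 y).1⟩
  · intro a
    refine (hR _).2 ⟨Matrix.vecMul a (hmat p), ?_⟩
    rw [Matrix.vecMul_vecMul, hB1]; simp
  · intro r hr hs h0
    obtain ⟨y, rfl⟩ := (hR r).1 hr
    obtain ⟨ha, hb⟩ := coords p B d hB2 y
    have hy0 : y 0 = 1 := by
      rw [hs] at ha
      exact mul_left_cancel₀ hdpos.ne' (by linarith)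
    obtain ⟨j, hj⟩ := hE.2 (fun k => y k.succ) (by
      rw [mem_hull_range]
      refine ⟨_, fun i => ?_, sum_real_one _ d hdpos hs, sum_real p _ d hdpos _ hb⟩
      exact div_nonneg (by exact_mod_cast h0 i) (by exact_mod_cast hdpos.le))
    refine ⟨j, ?_⟩
    have hy : y = Matrix.vecMul (Pi.single j 1 : Fin 4 → ℤ) (hmat p) := by
      ext k
      rw [Matrix.single_one_vecMul]
      refine Fin.cases ?_ (fun k => ?_) k
      · simp [hmat, hy0]
      · simpa [hmat] using congrFun hj k
    rw [hy, Matrix.vecMul_vecMul, hB1]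
    ext k; simp [Pi.single_apply, Matrix.vecMul_smul]
  · by_contra hcon
    push Not at hcon
    have hdv : ∀ k j, d ∣ B k j := by
      intro k j
      exact hcon (B k) ((hR _).2 ⟨Pi.single k 1, by rw [Matrix.single_one_vecMul]; rfl⟩) j
    choose B' hB' using hdv
    have hBB : B = d • Matrix.of B' := by ext k j; simp [hB']
    rw [hBB, Matrix.smul_mul] at hB2
    have hone : Matrix.of B' * hmat p = 1 := smul_right_injective _ hdpos.ne' hB2
    have hd1 := congrArg Matrix.det hone
    rw [Matrix.det_mul, Matrix.det_one] at hd1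
    have : |(hmat p).det| = 1 := Int.isUnit_iff_abs_eq.1 (IsUnit.of_mul_eq_one_right _ hd1)
    omega

theorem mem_corner (p : Fin 4 → Fin 3 → ℤ) (d : ℤ) (hd : 0 < d) (u : Fin 3 → ℤ) (c : Fin 4 → ℤ)
    (hc1 : ∑ i, c i = d) (hc2 : ∑ i, c i • p i = d • u) (i : Fin 4) (hi : c i < 0)
    (hj : ∀ j, j ≠ i → 0 ≤ c j + c i) : toR3 u ∈ cornerTet (fun j => toR3 (p j)) i := by
  have hdR : (0 : ℝ) < d := by exact_mod_cast hd
  have hiR : (c i : ℝ) < 0 := by exact_mod_cast hi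
  have hjR : ∀ j, j ≠ i → (0 : ℝ) ≤ c j + c i := fun j h => by exact_mod_cast hj j h
  have hc1R : ∑ i, (c i : ℝ) = d := by exact_mod_cast hc1
  have hu := sum_real p c d hd u hc2
  rw [cornerTet]
  refine mem_convexHull_of_exists_fintype
    (fun j => if j = i then -2 * (c i : ℝ) / d else ((c j : ℝ) + c i) / d)
    (fun j => if j = i then oppVert (fun j => toR3 (p j)) i else toR3 (p j)) ?_ ?_ ?_ ?_
  · intro j
    by_cases h : j = i
    · simp only [h, if_true]; apply div_nonneg <;> linarith
    · simp only [h, if_false]; exact div_nonneg (hjR j h) hdR.le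
  · rw [Fin.sum_univ_four] at hc1R ⊢
    fin_cases i <;> simp <;> field_simp <;> linarith
  · intro j
    by_cases h : j = i
    · simp [h]
    · simp only [h, if_false]; right; exact ⟨j, h, rfl⟩
  · rw [← hu]
    ext k
    simp only [Fin.sum_univ_four]
    fin_cases i <;> simp [oppVert] <;> field_simp <;> ring

theorem descend (P : Set (Fin 3 → ℝ)) (hconv : Convex ℝ P)
    (hprop : ∀ p : Fin 4 → Fin 3 → ℤ, EmptyLatticeTet p →
      convexHull ℝ (Set.range fun i => toR3 (p i)) ⊆ P →
      ∃ i, cornerTet (fun j => toR3 (p j)) i ⊆ P) (x : Fin 3 → ℝ) (n : ℕ) :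
    ∀ p : Fin 4 → Fin 3 → ℤ, (hmat p).det ≠ 0 → |(hmat p).det| = n → (∀ i, toR3 (p i) ∈ P) →
      x ∈ convexHull ℝ (Set.range fun i => toR3 (p i)) →
      ∃ S, IsUnimodularTet S ∧ S ⊆ P ∧ x ∈ S := by
  induction n using Nat.strong_induction_on with
  | _ n ih =>
  intro p hdet hn hpP hx
  have hsub : convexHull ℝ (Set.range fun i => toR3 (p i)) ⊆ P :=
    convexHull_min (by rintro _ ⟨i, rfl⟩; exact hpP i) hconv
  have hdpos : 0 < |(hmat p).det| := abs_pos.2 hdet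
  by_cases h1 : |(hmat p).det| = 1
  · refine ⟨_, ⟨p, ?_, ?_⟩, hsub, hx⟩
    · congr 1
      ext y
      simp [Fin.exists_fin_succ, eq_comm]
    · rw [hmat_det]
      rcases (abs_eq zero_le_one).1 h1 with h | h <;> simp [h]
  suffices hs : ∃ (u : Fin 3 → ℤ) (c : Fin 4 → ℤ), ∑ i, c i = |(hmat p).det| ∧
      ∑ i, c i • p i = |(hmat p).det| • u ∧ toR3 u ∈ P ∧ ∀ i, c i < |(hmat p).det| by
    obtain ⟨u, c, hc1, hc2, huP, hlt⟩ := hs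
    obtain ⟨l, hl, hl', hxl⟩ := improve p hdet u c hc1 hc2 x hx
    have := hlt l
    refine ih (c l).toNat (by omega) (Function.update p l u) ?_ (by omega) ?_ hxl
    · intro h0; rw [h0] at hl'; simp at hl'; omega
    · intro i
      by_cases h : i = l
      · subst h; simpa using huP
      · simpa [h] using hpP i
  by_cases hE : EmptyLatticeTet p
  · obtain ⟨i, hi⟩ := hprop p hE hsub
    obtain ⟨u, c, hc1, hc2, hc3, hc4⟩ := exists_corner p hE (by omega) i
    refine ⟨u, c, hc1, hc2, hi (mem_corner p _ hdpos u c hc1 hc2 i hc3 hc4), ?_⟩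
    intro j
    have a0 := hc4 0
    have a1 := hc4 1
    have a2 := hc4 2
    have a3 := hc4 3
    rw [Fin.sum_univ_four] at hc1
    fin_cases i <;> fin_cases j <;> simp at a0 a1 a2 a3 hc3 ⊢ <;> omega
  · have : ∃ z : Fin 3 → ℤ, toR3 z ∈ convexHull ℝ (Set.range fun i => toR3 (p i)) ∧
        ∀ i, z ≠ p i := by
      by_contra hcon
      push Not at hcon
      exact hE ⟨affInd p hdet, hcon⟩
    obtain ⟨z, hz, hzp⟩ := this
    obtain ⟨B, hB1, hB2⟩ := exists_B p
    obtain ⟨hc1, hc2⟩ := coords p B _ hB2 (Matrix.vecCons 1 z)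
    generalize Matrix.vecMul (Matrix.vecCons 1 z) B = c at hc1 hc2
    simp only [Matrix.cons_val_zero, mul_one, Matrix.cons_val_succ] at hc1 hc2
    refine ⟨z, c, hc1, hc2, hsub hz, ?_⟩
    obtain ⟨w, hw0, hw1, hwz⟩ := (mem_hull_range _ _).1 hz
    have hdR : (0 : ℝ) < (|(hmat p).det| : ℤ) := by exact_mod_cast hdpos
    have hwc : w - (fun i => (c i : ℝ) / (|(hmat p).det| : ℤ)) = 0 := by
      apply weights_zero p hdet
      · simp only [Pi.sub_apply, Finset.sum_sub_distrib, hw1, sum_real_one c _ hdpos hc1, sub_self]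
      · simp only [Pi.sub_apply, sub_smul, Finset.sum_sub_distrib, hwz,
          sum_real p c _ hdpos z hc2, sub_self]
    have hc0 : ∀ i, 0 ≤ c i := by
      intro i
      have h := congrFun hwc i
      simp only [Pi.sub_apply, Pi.zero_apply] at h
      have h' : (c i : ℝ) / (|(hmat p).det| : ℤ) = w i := by linarith
      rw [div_eq_iff hdR.ne'] at h'
      have : (0 : ℝ) ≤ c i := by rw [h']; exact mul_nonneg (hw0 i) hdR.le
      exact_mod_cast this
    intro i
    by_contra hi
    rw [not_lt] at hi
    have hz0 : ∀ j, j ≠ i → c j = 0 := by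
      intro j hj
      have h2 : c i + c j ≤ ∑ k, c k := by
        rw [← Finset.sum_pair hj.symm]
        exact Finset.sum_le_sum_of_subset_of_nonneg (Finset.subset_univ _) (fun k _ _ => hc0 k)
      have := hc0 j
      omega
    have hci : c i = |(hmat p).det| := by
      rw [← hc1, Finset.sum_eq_single i (fun j _ hj => hz0 j hj) (by simp)]
    rw [Finset.sum_eq_single i (fun j _ hj => by simp [hz0 j hj]) (by simp), hci] at hc2
    exact hzp i (smul_right_injective _ hdpos.ne' hc2).symm

/-- If a lattice 3-polytope `P` has the circumscribed parallelepiped property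
(for every empty lattice tetrahedron `T ⊆ P`, some corner tetrahedron of
`C(T)` is contained in `P`), then `P` has a unimodular cover. -/
theorem circumscribed_parallelepiped_property_implies_cover
    (V : Finset (Fin 3 → ℤ)) (P : Set (Fin 3 → ℝ))
    (hP : P = convexHull ℝ (toR3 '' ↑V))
    (hdim : affineSpan ℝ P = ⊤)
    (hprop : ∀ p : Fin 4 → Fin 3 → ℤ, EmptyLatticeTet p →
      convexHull ℝ (Set.range fun i => toR3 (p i)) ⊆ P →
      ∃ i, cornerTet (fun j => toR3 (p j)) i ⊆ P) :
    HasUnimodularCover P := by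
  subst hP
  have hconv := convex_convexHull ℝ (toR3 '' (V : Set (Fin 3 → ℤ)))
  rw [affineSpan_convexHull] at hdim
  refine ⟨{S | IsUnimodularTet S ∧ S ⊆ convexHull ℝ (toR3 '' (V : Set (Fin 3 → ℤ)))},
    fun S hS => hS, ?_⟩
  apply Set.Subset.antisymm
  · exact Set.sUnion_subset fun S hS => hS.2
  · intro x hx
    obtain ⟨q, hqS, hq, hxq⟩ := exists_tet _ hdim x hx
    choose p hpV hpq using hqS
    have hqp : q = fun i => toR3 (p i) := funext fun i => (hpq i).symm
    subst hqp
    have hdet := det_ne p hq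
    obtain ⟨S, h1, h2, h3⟩ := descend _ hconv hprop x (hmat p).det.natAbs p hdet (by simp)
      (fun i => subset_convexHull ℝ _ ⟨p i, hpV i, rfl⟩) hxq
    exact ⟨S, ⟨h1, h2⟩, h3⟩
end
end
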